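/- Suppose a double complex of complex vector spaces satisfies the d'd''-lemma at every (p,q) ∈ ℤ². Then for every k ∈ ℤ the natural map ⊕_{p+q=k} H_{BC}^{p,q} → H^k (sending the Bott-Chern class of α ∈ ker d' ∩ ker d'' ∩ A^{p,q} to the class of α in H^{p+q}) is an isomorphism. Equivalently, for every k: ker d' ∩ ker d'' ∩ Im d ∩ A^k = Im d'd'' ∩ A^k and ker d ∩ A^k = ((ker d' ∩ ker d'') + Im d) ∩ A^k. -/

import Mathlib

open Submodule

/-- A double complex of complex vector spaces, realized as an internally bigraded
module `W = ⊕_{p,q} A p q` together with global differentials `d'`, `d''` of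
bidegrees `(1,0)` and `(0,1)` satisfying `d'∘d' = 0`, `d''∘d'' = 0` and
`d'∘d'' + d''∘d' = 0`. -/
structure BiComplex (W : Type*) [AddCommGroup W] [Module ℂ W] where
  A : ℤ → ℤ → Submodule ℂ W
  d' : W →ₗ[ℂ] W
  d'' : W →ₗ[ℂ] W
  internal : DirectSum.IsInternal (fun pq : ℤ × ℤ => A pq.1 pq.2)
  map_d' : ∀ p q : ℤ, (A p q).map d' ≤ A (p + 1) q
  map_d'' : ∀ p q : ℤ, (A p q).map d'' ≤ A p (q + 1)
  d'_sq : d' ∘ₗ d' = 0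
  d''_sq : d'' ∘ₗ d'' = 0
  anticomm : d' ∘ₗ d'' + d'' ∘ₗ d' = 0

namespace BiComplex

variable {W : Type*} [AddCommGroup W] [Module ℂ W] (C : BiComplex W)

/-- `ker d' ∩ A^{p,q}` : the kernel of `d' : A^{p,q} → A^{p+1,q}`. -/
def kerd' (p q : ℤ) : Submodule ℂ W := LinearMap.ker C.d' ⊓ C.A p q

/-- `ker d'' ∩ A^{p,q}` : the kernel of `d'' : A^{p,q} → A^{p,q+1}`. -/
def kerd'' (p q : ℤ) : Submodule ℂ W := LinearMap.ker C.d'' ⊓ C.A p q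

/-- `Im d' ∩ A^{p,q} = d'(A^{p-1,q})`. -/
def imd' (p q : ℤ) : Submodule ℂ W := (C.A (p - 1) q).map C.d'

/-- `Im d'' ∩ A^{p,q} = d''(A^{p,q-1})`. -/
def imd'' (p q : ℤ) : Submodule ℂ W := (C.A p (q - 1)).map C.d''

/-- `Im d'd'' ∩ A^{p,q} = (d'∘d'')(A^{p-1,q-1})`. -/
def imd'd'' (p q : ℤ) : Submodule ℂ W := (C.A (p - 1) (q - 1)).map (C.d' ∘ₗ C.d'')

/-- `ker d'd'' ∩ A^{p,q}` : the kernel of `d'∘d'' : A^{p,q} → A^{p+1,q+1}`. -/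
def kerd'd'' (p q : ℤ) : Submodule ℂ W := LinearMap.ker (C.d' ∘ₗ C.d'') ⊓ C.A p q

/-- The `d'd''`-lemma at `(p,q)`:
`Im d' ∩ ker d'' ∩ A^{p,q} = ker d' ∩ Im d'' ∩ A^{p,q} = Im d'd'' ∩ A^{p,q}`. -/
def DDLemmaAt (p q : ℤ) : Prop :=
  C.imd' p q ⊓ C.kerd'' p q = C.imd'd'' p q ∧ C.kerd' p q ⊓ C.imd'' p q = C.imd'd'' p q

/-- The total-degree piece `A^k = ⊕_{p+q=k} A^{p,q}`. -/
def Atot (k : ℤ) : Submodule ℂ W := ⨆ p : ℤ, C.A p (k - p)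

/-- The total differential `d = d' + d''`. -/
def dtot : W →ₗ[ℂ] W := C.d' + C.d''

/-- `ker d ∩ A^k` : the kernel of `d : A^k → A^{k+1}`. -/
def kerdTot (k : ℤ) : Submodule ℂ W := LinearMap.ker C.dtot ⊓ C.Atot k

/-- `Im d ∩ A^k = d(A^{k-1})`. -/
def imdTot (k : ℤ) : Submodule ℂ W := (C.Atot (k - 1)).map C.dtot

/-- `ker d' ∩ ker d'' ∩ A^k = ⊕_{p+q=k} (ker d' ∩ ker d'' ∩ A^{p,q})`. -/
def kerd'kerd''Tot (k : ℤ) : Submodule ℂ W :=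
  ⨆ p : ℤ, (C.kerd' p (k - p) ⊓ C.kerd'' p (k - p))

/-- `Im d'd'' ∩ A^k = ⊕_{p+q=k} (Im d'd'' ∩ A^{p,q})`. -/
def imd'd''Tot (k : ℤ) : Submodule ℂ W := ⨆ p : ℤ, C.imd'd'' p (k - p)

/-- `ker d'd'' ∩ A^k = ⊕_{p+q=k} (ker d'd'' ∩ A^{p,q})`. -/
def kerd'd''Tot (k : ℤ) : Submodule ℂ W := ⨆ p : ℤ, C.kerd'd'' p (k - p)

/-- `Im d' ∩ A^k = ⊕_{p+q=k} (Im d' ∩ A^{p,q})`. -/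
def imd'Tot (k : ℤ) : Submodule ℂ W := ⨆ p : ℤ, C.imd' p (k - p)

/-- `Im d'' ∩ A^k = ⊕_{p+q=k} (Im d'' ∩ A^{p,q})`. -/
def imd''Tot (k : ℤ) : Submodule ℂ W := ⨆ p : ℤ, C.imd'' p (k - p)

/-- The double complex is totally bounded: `A^{p,q} = 0` for `|p| > N` or `|q| > N`. -/
def TotallyBounded : Prop :=
  ∃ N : ℕ, ∀ p q : ℤ, ((N : ℤ) < |p| ∨ (N : ℤ) < |q|) → C.A p q = ⊥

end BiComplex

/-- The quotient vector space `S / T` of a submodule `S` by (the trace of) a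
submodule `T ≤ S`. -/
abbrev quotSub {W : Type*} [AddCommGroup W] [Module ℂ W] (S T : Submodule ℂ W) :=
  S ⧸ (Submodule.comap S.subtype T)

namespace BiComplex

variable {W : Type*} [AddCommGroup W] [Module ℂ W] (C : BiComplex W)

lemma d'_d' (x : W) : C.d' (C.d' x) = 0 := LinearMap.congr_fun C.d'_sq x

lemma d''_d'' (x : W) : C.d'' (C.d'' x) = 0 := LinearMap.congr_fun C.d''_sq x

lemma d''_d' (x : W) : C.d'' (C.d' x) = -C.d' (C.d'' x) :=
  eq_neg_of_add_eq_zero_right (LinearMap.congr_fun C.anticomm x)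

lemma d'_mem {p q p' : ℤ} (hp : p + 1 = p') {x : W} (hx : x ∈ C.A p q) : C.d' x ∈ C.A p' q :=
  hp ▸ C.map_d' p q (mem_map_of_mem hx)

lemma d''_mem {p q q' : ℤ} (hq : q + 1 = q') {x : W} (hx : x ∈ C.A p q) : C.d'' x ∈ C.A p q' :=
  hq ▸ C.map_d'' p q (mem_map_of_mem hx)

/-- The projection of `W` onto its bidegree-`(p,q)` piece, as an endomorphism of `W`. -/
noncomputable def proj (p q : ℤ) : W →ₗ[ℂ] W :=
  (C.A p q).subtype ∘ₗ
    DirectSum.component ℂ (ℤ × ℤ) (fun pq : ℤ × ℤ => C.A pq.1 pq.2) (p, q) ∘ₗ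
    (LinearEquiv.ofBijective
      (DirectSum.coeLinearMap (fun pq : ℤ × ℤ => C.A pq.1 pq.2)) C.internal).symm.toLinearMap

lemma proj_mem (p q : ℤ) (x : W) : C.proj p q x ∈ C.A p q := Subtype.coe_prop _

lemma ofBijective_symm_apply {p q : ℤ} {x : W} (hx : x ∈ C.A p q) :
    (LinearEquiv.ofBijective
      (DirectSum.coeLinearMap (fun pq : ℤ × ℤ => C.A pq.1 pq.2)) C.internal).symm x =
      DirectSum.lof ℂ (ℤ × ℤ) (fun pq : ℤ × ℤ => C.A pq.1 pq.2) (p, q) ⟨x, hx⟩ := by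
  rw [LinearEquiv.symm_apply_eq]
  exact (DirectSum.coeLinearMap_lof (fun pq : ℤ × ℤ => C.A pq.1 pq.2) (p, q) ⟨x, hx⟩).symm

lemma proj_of_mem {p q : ℤ} {x : W} (hx : x ∈ C.A p q) : C.proj p q x = x := by
  simp [proj, C.ofBijective_symm_apply hx, DirectSum.component.lof_self]

lemma proj_of_mem_of_ne {p q p' q' : ℤ} (hne : (p, q) ≠ (p', q')) {x : W}
    (hx : x ∈ C.A p q) : C.proj p' q' x = 0 := by
  simp [proj, C.ofBijective_symm_apply hx, DirectSum.component.of, hne]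

lemma hom_ext {f g : W →ₗ[ℂ] W} (hfg : ∀ p q, ∀ x ∈ C.A p q, f x = g x) : f = g := by
  ext x
  have hx : x ∈ ⨆ pq : ℤ × ℤ, C.A pq.1 pq.2 := C.internal.submodule_iSup_eq_top ▸ mem_top
  induction hx using iSup_induction' with
  | mem pq x hx => exact hfg _ _ x hx
  | zero => simp
  | add x y _ _ hx hy => simp [hx, hy]

lemma proj_d' (p q : ℤ) (x : W) : C.proj p q (C.d' x) = C.d' (C.proj (p - 1) q x) := by
  refine LinearMap.congr_fun (C.hom_ext (f := C.proj p q ∘ₗ C.d')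
    (g := C.d' ∘ₗ C.proj (p - 1) q) fun a b x hx => ?_) x
  have hd : C.d' x ∈ C.A (a + 1) b := C.d'_mem rfl hx
  by_cases hab : (a + 1, b) = (p, q)
  · obtain ⟨rfl, rfl⟩ := Prod.mk.inj hab
    simp [C.proj_of_mem hd, C.proj_of_mem hx]
  · have hab' : (a, b) ≠ (p - 1, q) := by grind
    simp [C.proj_of_mem_of_ne hab hd, C.proj_of_mem_of_ne hab' hx]

lemma proj_d'' (p q : ℤ) (x : W) : C.proj p q (C.d'' x) = C.d'' (C.proj p (q - 1) x) := by
  refine LinearMap.congr_fun (C.hom_ext (f := C.proj p q ∘ₗ C.d'')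
    (g := C.d'' ∘ₗ C.proj p (q - 1)) fun a b x hx => ?_) x
  have hd : C.d'' x ∈ C.A a (b + 1) := C.d''_mem rfl hx
  by_cases hab : (a, b + 1) = (p, q)
  · obtain ⟨rfl, rfl⟩ := Prod.mk.inj hab
    simp [C.proj_of_mem hd, C.proj_of_mem hx]
  · have hab' : (a, b) ≠ (p, q - 1) := by grind
    simp [C.proj_of_mem_of_ne hab hd, C.proj_of_mem_of_ne hab' hx]

lemma d'_proj (p q : ℤ) (x : W) : C.d' (C.proj p q x) = C.proj (p + 1) q (C.d' x) := by
  simp [proj_d']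

lemma d''_proj (p q : ℤ) (x : W) : C.d'' (C.proj p q x) = C.proj p (q + 1) (C.d'' x) := by
  simp [proj_d'']

lemma le_iSup_diagonal (N : ℤ → ℤ → Submodule ℂ W) {p q k : ℤ} (hpq : p + q = k) :
    N p q ≤ ⨆ p : ℤ, N p (k - p) := by
  obtain rfl : q = k - p := by omega
  exact le_iSup (fun p => N p (k - p)) p

lemma mem_iSup_of_proj_mem {k : ℤ} {x : W} (hx : x ∈ C.Atot k) {N : ℤ → Submodule ℂ W}
    (hN : ∀ p, C.proj p (k - p) x ∈ N p) : x ∈ ⨆ p, N p := by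
  obtain ⟨f, hf, rfl⟩ := (mem_iSup_iff_exists_finsupp _ _).1 hx
  refine (mem_iSup_iff_exists_finsupp _ _).2 ⟨f, fun p => ?_, rfl⟩
  have hp : C.proj p (k - p) (f.sum fun _ y => y) = f p := by
    rw [Finsupp.sum, map_sum, Finset.sum_eq_single p]
    · exact C.proj_of_mem (hf p)
    · intro a _ ha
      exact C.proj_of_mem_of_ne (fun he => ha (Prod.mk.inj he).1) (hf a)
    · intro hp
      simp [Finsupp.notMem_support_iff.1 hp]
  exact hp ▸ hN p

lemma Atot_le_comap_d' {k l : ℤ} (hkl : k + 1 = l) : C.Atot k ≤ (C.Atot l).comap C.d' :=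
  iSup_le fun p _ hx =>
    le_iSup_diagonal C.A (q := k - p) (by omega) (C.d'_mem rfl hx)

lemma Atot_le_comap_d'' {k l : ℤ} (hkl : k + 1 = l) : C.Atot k ≤ (C.Atot l).comap C.d'' :=
  iSup_le fun p _ hx =>
    le_iSup_diagonal C.A (p := p) (by omega) (C.d''_mem rfl hx)

lemma dtot_mem_Atot {k l : ℤ} (hkl : k + 1 = l) {x : W} (hx : x ∈ C.Atot k) :
    C.dtot x ∈ C.Atot l :=
  add_mem (C.Atot_le_comap_d' hkl hx) (C.Atot_le_comap_d'' hkl hx)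

lemma kerd'kerd''Tot_eq (k : ℤ) :
    C.kerd'kerd''Tot k = LinearMap.ker C.d' ⊓ LinearMap.ker C.d'' ⊓ C.Atot k := by
  apply le_antisymm
  · exact iSup_le fun p x hx =>
      ⟨⟨hx.1.1, hx.2.1⟩, le_iSup (fun p => C.A p (k - p)) p hx.1.2⟩
  · rintro x ⟨⟨h', h''⟩, hx⟩
    rw [SetLike.mem_coe, LinearMap.mem_ker] at h' h''
    refine C.mem_iSup_of_proj_mem hx fun p => ⟨⟨?_, C.proj_mem _ _ _⟩, ?_, C.proj_mem _ _ _⟩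
    · simp [d'_proj, h']
    · simp [d''_proj, h'']

lemma imd'd''Tot_eq {k l : ℤ} (hkl : l + 2 = k) :
    C.imd'd''Tot k = (C.Atot l).map (C.d' ∘ₗ C.d'') := by
  rw [imd'd''Tot, Atot, Submodule.map_iSup]
  apply le_antisymm
  · refine iSup_le fun p => ?_
    exact le_iSup_diagonal (fun p q => (C.A p q).map (C.d' ∘ₗ C.d'')) (by omega)
  · refine iSup_le fun p => ?_
    have hp : (C.A p (l - p)).map (C.d' ∘ₗ C.d'') = C.imd'd'' (p + 1) (l - p + 1) := by
      simp [imd'd'']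
    exact hp ▸ le_iSup_diagonal C.imd'd'' (by omega)

lemma mem_kerd'd''Tot {k : ℤ} {x : W} (hx : x ∈ C.Atot k) (h0 : C.d' (C.d'' x) = 0) :
    x ∈ C.kerd'd''Tot k := by
  refine C.mem_iSup_of_proj_mem hx fun p => ⟨?_, C.proj_mem _ _ _⟩
  simp [d'_proj, d''_proj, h0]

variable {C} in
lemma map_dtot_kerd'd''Tot_le (h : ∀ p q : ℤ, C.DDLemmaAt p q) (k : ℤ) :
    (C.kerd'd''Tot (k - 1)).map C.dtot ≤ C.imd'd''Tot k := by
  rw [kerd'd''Tot, Submodule.map_iSup]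
  refine iSup_le fun p => ?_
  rintro _ ⟨x, ⟨h0, hx⟩, rfl⟩
  replace h0 : C.d' (C.d'' x) = 0 := h0
  refine add_mem ?_ ?_
  · refine le_iSup_diagonal C.imd'd'' (p := p + 1) (q := k - 1 - p) (by omega) ?_
    rw [← (h _ _).1]
    exact ⟨⟨x, by simpa using hx, rfl⟩, by simp [d''_d', h0], C.d'_mem rfl hx⟩
  · refine le_iSup_diagonal C.imd'd'' (p := p) (q := k - 1 - p + 1) (by omega) ?_
    rw [← (h _ _).2]
    exact ⟨⟨h0, C.d''_mem rfl hx⟩, ⟨x, by simpa using hx, rfl⟩⟩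

variable {C} in
lemma d'_mem_imd'd''Tot (h : ∀ p q : ℤ, C.DDLemmaAt p q) {k : ℤ} {x : W} (hx : x ∈ C.Atot k)
    (h0 : C.d' (C.d'' x) = 0) : C.d' x ∈ C.imd'd''Tot (k + 1) := by
  refine C.mem_iSup_of_proj_mem (C.Atot_le_comap_d' rfl hx) fun p => ?_
  rw [← (h _ _).1]
  refine ⟨?_, ?_, C.proj_mem _ _ _⟩
  · rw [proj_d']
    exact mem_map_of_mem (C.proj_mem _ _ _)
  · simp [d''_proj, d''_d', h0]

end BiComplex

/-- If the double complex satisfies the `d'd''`-lemma at every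
`(p,q)`, then for every `k` the natural map `⊕_{p+q=k} H_BC^{p,q} → H^k` is an
isomorphism; equivalently, for every `k`:
`ker d' ∩ ker d'' ∩ Im d ∩ A^k = Im d'd'' ∩ A^k` and
`ker d ∩ A^k = ((ker d' ∩ ker d'') + Im d) ∩ A^k`. -/
theorem bicomplex_ddlemma_implies_BC_eq_deRham
    {W : Type*} [AddCommGroup W] [Module ℂ W] (C : BiComplex W)
    (h : ∀ p q : ℤ, C.DDLemmaAt p q) :
    ∀ k : ℤ,
      C.kerd'kerd''Tot k ⊓ C.imdTot k = C.imd'd''Tot k ∧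
      C.kerdTot k = C.kerd'kerd''Tot k ⊔ C.imdTot k := by
  intro k
  constructor
  · rw [C.kerd'kerd''Tot_eq]
    apply le_antisymm
    · rintro _ ⟨⟨⟨h', -⟩, -⟩, z, hz, rfl⟩
      have h0 : C.d' (C.d'' z) = 0 := by
        simpa [BiComplex.dtot, C.d'_d'] using h'
      exact BiComplex.map_dtot_kerd'd''Tot_le h k (mem_map_of_mem (C.mem_kerd'd''Tot hz h0))
    · rw [C.imd'd''Tot_eq (l := k - 2) (by omega)]
      rintro _ ⟨w, hw, rfl⟩
      have hw' : C.d'' w ∈ C.Atot (k - 1) := C.Atot_le_comap_d'' (by omega) hw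
      refine ⟨⟨⟨?_, ?_⟩, C.Atot_le_comap_d' (by omega) hw'⟩, C.d'' w, hw', ?_⟩
      · simp [C.d'_d']
      · simp [C.d''_d', C.d''_d'']
      · simp [BiComplex.dtot, C.d''_d'']
  · rw [C.kerd'kerd''Tot_eq]
    apply le_antisymm
    · rintro x ⟨hd, hx⟩
      replace hd : C.d' x + C.d'' x = 0 := hd
      have hd'' : C.d'' x = -C.d' x := eq_neg_of_add_eq_zero_right hd
      have hmem := BiComplex.d'_mem_imd'd''Tot h hx (by simp [hd'', C.d'_d'])
      rw [C.imd'd''Tot_eq (l := k - 1) (by omega)] at hmem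
      obtain ⟨w, hw, hwx⟩ := hmem
      replace hwx : C.d' (C.d'' w) = C.d' x := hwx
      refine mem_sup.2 ⟨x - C.dtot w, ⟨⟨?_, ?_⟩, sub_mem hx (C.dtot_mem_Atot (by omega) hw)⟩,
        C.dtot w, mem_map_of_mem hw, sub_add_cancel _ _⟩
      · simp [BiComplex.dtot, C.d'_d', hwx]
      · simp [BiComplex.dtot, C.d''_d'', C.d''_d', hwx, hd'']
    · refine sup_le ?_ ?_
      · rintro x ⟨⟨h', h''⟩, hx⟩
        rw [SetLike.mem_coe, LinearMap.mem_ker] at h' h''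
        exact ⟨by simp [BiComplex.dtot, h', h''], hx⟩
      · rintro _ ⟨z, hz, rfl⟩
        refine ⟨?_, C.dtot_mem_Atot (by omega) hz⟩
        simp [BiComplex.dtot, C.d'_d', C.d''_d'', C.d''_d']
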